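/- Translation invariant regularising kernels: let β, ρ > 0 and m, r ∈ ℕ₀, and let 𝖪 : ℝ^d → ℝ satisfy, for every multi-index k with |k| ≤ m + r, |∂^k 𝖪(z)| ≲ |z|^{−(d−β+|k|)} · 1_{{|z| ≤ ρ}}. Then the kernel 𝖪(x,y) := 𝖪(x−y) is a β-regularising kernel of order (m,r) with range ρ, and it preserves polynomials at every level γ ∈ ℝ (for every n and |k| ≤ γ, x ↦ ∫ 𝖪_n(x,y) y^k dy is a polynomial of degree ≤ |k|). -/

import Mathlib

open MeasureTheory Metric Filter
open scoped Classical Pointwise Topology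

noncomputable section

/-- Euclidean space `ℝ^d`. -/
abbrev Ed (d : ℕ) := EuclideanSpace ℝ (Fin d)

/-- Multi-indices `k ∈ ℕ₀^d`. -/
abbrev MIdx (d : ℕ) := Fin d → ℕ

variable {d : ℕ}

/-- Degree `|k|` of a multi-index. -/
def mdeg (k : MIdx d) : ℕ := ∑ i, k i

/-- Factorial `k!` of a multi-index. -/
def mfact (k : MIdx d) : ℕ := ∏ i, Nat.factorial (k i)

/-- Monomial `v^k`. -/
def mpow (v : Ed d) (k : MIdx d) : ℝ := ∏ i, (v i) ^ (k i)

/-- Partial (line) derivative in coordinate `i`. -/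
def pd (i : Fin d) (f : Ed d → ℝ) : Ed d → ℝ :=
  fun x => lineDeriv ℝ f x (EuclideanSpace.single i (1:ℝ))

/-- Iterated partial derivative `∂^k`. -/
def mderiv (k : MIdx d) (f : Ed d → ℝ) : Ed d → ℝ :=
  (List.finRange d).foldr (fun i g => (pd i)^[k i] g) f

/-- Smooth compactly supported test function. -/
def IsTest (φ : Ed d → ℝ) : Prop := ContDiff ℝ (⊤ : ℕ∞) φ ∧ HasCompactSupport φ

/-- The `C^r` norm `max_{|k| ≤ r} ‖∂^k φ‖_∞`. -/
def crNorm (r : ℕ) (φ : Ed d → ℝ) : ℝ :=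
  ⨆ k : {k : MIdx d // mdeg k ≤ r}, ⨆ x : Ed d, |mderiv k.1 φ x|

/-- Generalized functions: arbitrary functionals on functions on `ℝ^d`. -/
abbrev DFunc (d : ℕ) := (Ed d → ℝ) → ℝ

/-- `f` is a distribution in `𝒟'(ℝ^d)`: linear on test functions and,
on every compact, bounded by some `C^r` norm. -/
def IsDistribution (f : DFunc d) : Prop :=
  (∀ φ ψ : Ed d → ℝ, IsTest φ → IsTest ψ → f (φ + ψ) = f φ + f ψ) ∧
  (∀ (c : ℝ) (φ : Ed d → ℝ), IsTest φ → f (c • φ) = c * f φ) ∧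
  (∀ K : Set (Ed d), IsCompact K → ∃ (r : ℕ) (C : ℝ),
    ∀ φ : Ed d → ℝ, IsTest φ → tsupport φ ⊆ K → |f φ| ≤ C * crNorm r φ)

/-- `f` is a distribution of order `r` (bound by the `C^r` norm on every compact). -/
def DistOrder (f : DFunc d) (r : ℕ) : Prop :=
  ∀ K : Set (Ed d), IsCompact K → ∃ C : ℝ,
    ∀ φ : Ed d → ℝ, IsTest φ → tsupport φ ⊆ K → |f φ| ≤ C * crNorm r φ

/-- `φ` is of class `C^r`: all iterated coordinate-partials up to order `r`
exist and are continuous. -/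
def IsCr (r : ℕ) (φ : Ed d → ℝ) : Prop :=
  ∀ k : MIdx d, mdeg k ≤ r →
    Continuous (mderiv k φ) ∧
    (mdeg k < r → ∀ (i : Fin d) (x : Ed d),
      LineDifferentiableAt ℝ (mderiv k φ) x (EuclideanSpace.single i (1:ℝ)))

/-- The functional `f` acts canonically (linearly, with local order-`r` bounds) on all
compactly supported `C^r` functions; i.e. `f` incorporates the canonical extension of a
distribution of order `r`. -/
def OrderExt (f : DFunc d) (r : ℕ) : Prop :=
  (∀ φ ψ : Ed d → ℝ, IsCr r φ → HasCompactSupport φ → IsCr r ψ → HasCompactSupport ψ →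
      f (φ + ψ) = f φ + f ψ) ∧
  (∀ (c : ℝ) (φ : Ed d → ℝ), IsCr r φ → HasCompactSupport φ → f (c • φ) = c * f φ) ∧
  (∀ K : Set (Ed d), IsCompact K → ∃ C : ℝ,
    ∀ φ : Ed d → ℝ, IsCr r φ → HasCompactSupport φ → tsupport φ ⊆ K → |f φ| ≤ C * crNorm r φ)

/-- The scaled recentred test function `φ_x^λ(y) = λ^{-d} φ(λ^{-1}(y-x))`. -/
def scTF (φ : Ed d → ℝ) (x : Ed d) (l : ℝ) : Ed d → ℝ :=
  fun y => (l ^ d)⁻¹ * φ (l⁻¹ • (y - x))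

/-- The class `𝓑^r` of smooth test functions supported in the closed unit ball with
all derivatives of order `≤ r` bounded by one. -/
def TB (d r : ℕ) : Set (Ed d → ℝ) :=
  {φ | IsTest φ ∧ tsupport φ ⊆ closedBall (0 : Ed d) 1 ∧
    ∀ k : MIdx d, mdeg k ≤ r → ∀ x, |mderiv k φ x| ≤ 1}

/-- The class `𝓑_γ` of smooth test functions supported in the closed unit ball which
annihilate all monomials of degree `≤ γ`. -/
def TAnn (d : ℕ) (γ : ℝ) : Set (Ed d → ℝ) :=
  {φ | IsTest φ ∧ tsupport φ ⊆ closedBall (0 : Ed d) 1 ∧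
    ∀ k : MIdx d, (mdeg k : ℝ) ≤ γ → (∫ z, φ z * mpow z k) = 0}

/-- The class `𝓑^r_γ = 𝓑^r ∩ 𝓑_γ`. -/
def TBAnn (d r : ℕ) (γ : ℝ) : Set (Ed d → ℝ) := TB d r ∩ TAnn d γ

/-- A germ: a family of functionals indexed by base points. -/
abbrev GermF (d : ℕ) := Ed d → DFunc d

/-- A germ of distributions, measurable in the base point. -/
def IsGerm (F : GermF d) : Prop :=
  (∀ x, IsDistribution (F x)) ∧ ∀ φ : Ed d → ℝ, IsTest φ → Measurable (fun x => F x φ)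

/-- Homogeneity bound with constant `C`: `|F_x(φ_x^λ)| ≤ C λ^ᾱ` on `(K, λ̄)` at order `r`. -/
def HomB (F : GermF d) (a : ℝ) (r : ℕ) (K : Set (Ed d)) (lb C : ℝ) : Prop :=
  ∀ x ∈ K, ∀ l : ℝ, 0 < l → l ≤ lb → ∀ φ ∈ TB d r, |F x (scTF φ x l)| ≤ C * l ^ a

/-- Coherence bound with constant `C`:
`|(F_y - F_x)(φ_x^λ)| ≤ C λ^α (|y-x|+λ)^{γ-α}` on `(K, λ̄)` at order `r`. -/
def CohB (F : GermF d) (a g : ℝ) (r : ℕ) (K : Set (Ed d)) (lb C : ℝ) : Prop :=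
  ∀ x ∈ K, ∀ y ∈ K, ∀ l : ℝ, 0 < l → l ≤ lb → ∀ φ ∈ TB d r,
    |F y (scTF φ x l) - F x (scTF φ x l)| ≤ C * l ^ a * (dist y x + l) ^ (g - a)

/-- `F` is `ᾱ`-homogeneous of order `r`. -/
def Homog (F : GermF d) (a : ℝ) (r : ℕ) : Prop :=
  ∀ K : Set (Ed d), IsCompact K → ∀ lb : ℝ, 1 ≤ lb → ∃ C, HomB F a r K lb C

/-- `F` is `(α, γ)`-coherent of order `r`. -/
def Coh (F : GermF d) (a g : ℝ) (r : ℕ) : Prop :=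
  ∀ K : Set (Ed d), IsCompact K → ∀ lb : ℝ, 1 ≤ lb → ∃ C, CohB F a g r K lb C

/-- Weak homogeneity bound with constant `C` (test functions annihilating polynomials
at small scales, plus a scale-one bound on all of `𝓑^r`). -/
def WHomB (F : GermF d) (a : ℝ) (r : ℕ) (K : Set (Ed d)) (lb C : ℝ) : Prop :=
  (∀ x ∈ K, ∀ l : ℝ, 0 < l → l ≤ lb → ∀ φ ∈ TBAnn d r a,
      |F x (scTF φ x l)| ≤ C * l ^ a) ∧
  (∀ x ∈ K, ∀ ψ ∈ TB d r, |F x (scTF ψ x 1)| ≤ C)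

/-- Weak coherence bound with constant `C`. -/
def WCohB (F : GermF d) (a g : ℝ) (r : ℕ) (K : Set (Ed d)) (lb C : ℝ) : Prop :=
  (∀ x ∈ K, ∀ y ∈ K, ∀ l : ℝ, 0 < l → l ≤ lb → ∀ φ ∈ TBAnn d r g,
      |F y (scTF φ x l) - F x (scTF φ x l)| ≤ C * l ^ a * (dist y x + l) ^ (g - a)) ∧
  (∀ x ∈ K, ∀ y ∈ K, ∀ ψ ∈ TB d r, |F y (scTF ψ x 1) - F x (scTF ψ x 1)| ≤ C)

/-- `F` is weakly `ᾱ`-homogeneous of order `r`. -/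
def WHomog (F : GermF d) (a : ℝ) (r : ℕ) : Prop :=
  ∀ K : Set (Ed d), IsCompact K → ∀ lb : ℝ, 1 ≤ lb → ∃ C, WHomB F a r K lb C

/-- `F` is weakly `(α,γ)`-coherent of order `r`. -/
def WCoh (F : GermF d) (a g : ℝ) (r : ℕ) : Prop :=
  ∀ K : Set (Ed d), IsCompact K → ∀ lb : ℝ, 1 ≤ lb → ∃ C, WCohB F a g r K lb C

/-- The canonical order `r_{ᾱ,α} = min{n ∈ ℕ₀ : n > max(-ᾱ, -α)}`. -/
def rJ (a b : ℝ) : ℕ := (⌊max (-a) (-b)⌋ + 1).toNat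

/-- Joint homogeneity-and-coherence bound at the canonical order. -/
def JointB (F : GermF d) (ab a g : ℝ) (K : Set (Ed d)) (lb C : ℝ) : Prop :=
  HomB F ab (rJ ab a) K lb C ∧ CohB F a g (rJ ab a) K lb C

/-- Joint weak homogeneity-and-coherence bound at the canonical order. -/
def WJointB (F : GermF d) (ab a g : ℝ) (K : Set (Ed d)) (lb C : ℝ) : Prop :=
  WHomB F ab (rJ ab a) K lb C ∧ WCohB F a g (rJ ab a) K lb C

/-- `R` is a `γ`-reconstruction of the `(α,γ)`-coherent germ `F`. -/
def IsRec (F : GermF d) (R : DFunc d) (a g : ℝ) : Prop :=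
  ∀ r : ℕ, -a < (r : ℝ) → ∀ K : Set (Ed d), IsCompact K → ∃ C : ℝ,
    ∀ x ∈ K, ∀ l : ℝ, 0 < l → l ≤ 1 → ∀ φ ∈ TB d r,
      |F x (scTF φ x l) - R (scTF φ x l)| ≤ C * l ^ g

/-- Mixed partial derivative `∂_1^k ∂_2^l K(x,y)` of a kernel. -/
def mixDeriv (k l : MIdx d) (Kf : Ed d → Ed d → ℝ) (x y : Ed d) : ℝ :=
  mderiv k (fun x' => mderiv l (fun y' => Kf x' y') y) x

/-- The kernel `K(x,y)` is of class `C^{m,r}` (mixed partials `∂_1^k ∂_2^l`, `|k| ≤ m`,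
`|l| ≤ r`, exist and are continuous). -/
def IsCmr (m r : ℕ) (Kf : Ed d → Ed d → ℝ) : Prop :=
  ∀ k l : MIdx d, mdeg k ≤ m → mdeg l ≤ r →
    Continuous (fun p : Ed d × Ed d => mixDeriv k l Kf p.1 p.2) ∧
    (mdeg k < m → ∀ (i : Fin d) (x y : Ed d),
      LineDifferentiableAt ℝ (fun x' => mixDeriv k l Kf x' y) x
        (EuclideanSpace.single i (1:ℝ))) ∧
    (mdeg l < r → ∀ (j : Fin d) (x y : Ed d),
      LineDifferentiableAt ℝ (mderiv l (fun y' => Kf x y')) y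
        (EuclideanSpace.single j (1:ℝ)))

/-- `Kn` is the dyadic decomposition of a `β`-regularising kernel of order `(m,r)`
with range `ρ` (Definition 2.3 of the paper). -/
def RegKer (d : ℕ) (β : ℝ) (m r : ℕ) (ρ : ℝ) (Kn : ℕ → Ed d → Ed d → ℝ) : Prop :=
  (∀ n, IsCmr m r (Kn n)) ∧
  (∀ n x y, Kn n x y ≠ 0 → dist x y ≤ ρ * 2 ^ (-(n : ℝ))) ∧
  (∀ K : Set (Ed d), IsCompact K → ∃ c : ℝ, 0 < c ∧
    (∀ n, ∀ k l : MIdx d, mdeg k ≤ m → mdeg l ≤ r → ∀ x ∈ K, ∀ y ∈ K,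
      |mixDeriv k l (Kn n) x y| ≤
        c * 2 ^ ((((d : ℝ) - β + (mdeg l : ℝ) + (mdeg k : ℝ))) * n)) ∧
    (∀ n, ∀ k l : MIdx d, mdeg k ≤ r → mdeg l ≤ r → ∀ y ∈ K,
      |∫ x, mpow (y - x) l * mderiv k (fun y' => Kn n x y') y| ≤ c * 2 ^ (-(β * (n : ℝ)))))

/-- `K_n^* ψ (y) = ∫ ψ(x) K_n(x,y) dx`. -/
def kstar (Kf : Ed d → Ed d → ℝ) (ψ : Ed d → ℝ) : Ed d → ℝ :=
  fun y => ∫ x, ψ x * Kf x y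

/-- `g = 𝖪 f`, i.e. `g(ψ) = Σ_n f(K_n^* ψ)` (with convergence) on test functions. -/
def KInt (Kn : ℕ → Ed d → Ed d → ℝ) (f g : DFunc d) : Prop :=
  ∀ ψ : Ed d → ℝ, IsTest ψ → HasSum (fun n => f (kstar (Kn n) ψ)) (g ψ)

/-- The kernel decomposition preserves polynomials at level `γ`. -/
def PresPoly (Kn : ℕ → Ed d → Ed d → ℝ) (γ : ℝ) : Prop :=
  ∀ n, ∀ k : MIdx d, (mdeg k : ℝ) ≤ γ →
    ∃ p : MvPolynomial (Fin d) ℝ, p.totalDegree ≤ mdeg k ∧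
      ∀ x : Ed d, (∫ y, Kn n x y * mpow y k) = MvPolynomial.eval (fun i => x i) p

/-- Distributional derivative `D^k f (φ) = (-1)^{|k|} f(∂^k φ)`. -/
def distDeriv (k : MIdx d) (f : DFunc d) : DFunc d :=
  fun φ => (-1 : ℝ) ^ (mdeg k) * f (mderiv k φ)

/-- `η ∈ 𝒟` with `∫ η = 1` and vanishing moments of orders `1 ≤ |l| < δ`. -/
def GoodEta (δ : ℝ) (η : Ed d → ℝ) : Prop :=
  IsTest η ∧ (∫ z, η z) = 1 ∧
    ∀ k : MIdx d, 1 ≤ mdeg k → (mdeg k : ℝ) < δ → (∫ z, η z * mpow z k) = 0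

/-- `v` is the pointwise derivative `D^k f(x)`, defined through the limit
`lim_{λ↓0} D^k f(η_x^λ)` for every admissible mollifier `η`. -/
def HasPtDeriv (f : DFunc d) (δ : ℝ) (k : MIdx d) (x : Ed d) (v : ℝ) : Prop :=
  ∀ η : Ed d → ℝ, GoodEta δ η →
    Tendsto (fun l : ℝ => distDeriv k f (scTF η x l)) (nhdsWithin 0 (Set.Ioi 0)) (nhds v)

/-- The Taylor polynomial `Σ_{|k| < δ} c_k (·-x)^k / k!`, viewed as the functional
`ψ ↦ Σ_{|k| < δ} c_k ∫ ψ(y) (y-x)^k / k! dy`. -/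
def taylorF (δ : ℝ) (c : MIdx d → ℝ) (x : Ed d) : DFunc d :=
  fun ψ => ∑ᶠ k ∈ {k : MIdx d | (mdeg k : ℝ) < δ},
    c k * ((∫ y, ψ y * mpow (y - x) k) / (mfact k))

/-- The smallest positive integer `> -γ` (used in Hölder–Zygmund spaces for `γ < 0`). -/
def rNeg (γ : ℝ) : ℕ := (⌊-γ + 1⌋).toNat

/-- The Hölder–Zygmund bound with constant `C` on the compact `K` (with `λ̄ = 1`). -/
def ZBound (γ : ℝ) (f : DFunc d) (K : Set (Ed d)) (C : ℝ) : Prop :=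
  (γ < 0 → ∀ x ∈ K, ∀ l : ℝ, 0 < l → l ≤ 1 → ∀ φ ∈ TB d (rNeg γ),
    |f (scTF φ x l)| ≤ C * l ^ γ) ∧
  (0 ≤ γ →
    (∀ x ∈ K, ∀ ψ ∈ TB d 0, |f (scTF ψ x 1)| ≤ C) ∧
    (∀ x ∈ K, ∀ l : ℝ, 0 < l → l ≤ 1 → ∀ φ ∈ TBAnn d 0 γ,
      |f (scTF φ x l)| ≤ C * l ^ γ))

/-- Membership in the local Hölder–Zygmund space `𝒵^γ`. -/
def MemZ (γ : ℝ) (f : DFunc d) : Prop :=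
  IsDistribution f ∧ ∀ K : Set (Ed d), IsCompact K → ∃ C, ZBound γ f K C

/-- `(Pg, Gg)` is a model with homogeneities `α` of order `rP`, with index set `S`. -/
def IsModelOn {ι : Type} (S : Finset ι) (Pg : ι → GermF d)
    (Gg : ι → ι → Ed d → Ed d → ℝ) (α : ι → ℝ) (rP : ℕ) : Prop :=
  (∀ i ∈ S, IsGerm (Pg i)) ∧
  (∀ i ∈ S, Homog (Pg i) (α i) rP) ∧
  (∀ i ∈ S, ∀ x y : Ed d, ∀ φ : Ed d → ℝ, IsTest φ →
    Pg i y φ = ∑ j ∈ S, Pg j x φ * Gg j i x y)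

/-- The modelled-distribution bound with constant `C` on the compact `K`. -/
def MDB {ι : Type} (S : Finset ι) (Gg : ι → ι → Ed d → Ed d → ℝ) (α : ι → ℝ)
    (γ : ℝ) (f : Ed d → ι → ℝ) (K : Set (Ed d)) (C : ℝ) : Prop :=
  (∀ x ∈ K, ∀ i ∈ S, |f x i| ≤ C) ∧
  (∀ x ∈ K, ∀ y ∈ K, ∀ i ∈ S,
    |(∑ j ∈ S, Gg i j x y * f y j) - f x i| ≤ C * (dist y x) ^ (γ - α i))

/-- `f` is a modelled distribution of order `γ` relative to the model data. -/
def IsMD {ι : Type} (S : Finset ι) (Gg : ι → ι → Ed d → Ed d → ℝ) (α : ι → ℝ)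
    (γ : ℝ) (f : Ed d → ι → ℝ) : Prop :=
  (∀ i ∈ S, Measurable fun x : Ed d => f x i) ∧
  ∀ K : Set (Ed d), IsCompact K → ∃ C, MDB S Gg α γ f K C

/-- The germ `⟨f, Π⟩_x = Σ_i f^i(x) Π^i_x`. -/
def germOf {ι : Type} (S : Finset ι) (Pg : ι → GermF d) (f : Ed d → ι → ℝ) : GermF d :=
  fun x φ => ∑ i ∈ S, f x i * Pg i x φ

/-- `φ` is of class `C^r` on the set `s`. -/
def IsCrOn {d : ℕ} (r : ℕ) (s : Set (Ed d)) (φ : Ed d → ℝ) : Prop :=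
  ∀ k : MIdx d, mdeg k ≤ r →
    ContinuousOn (mderiv k φ) s ∧
    (mdeg k < r → ∀ (i : Fin d), ∀ x ∈ s,
      LineDifferentiableAt ℝ (mderiv k φ) x (EuclideanSpace.single i (1:ℝ)))


abbrev ee (i : Fin d) : Ed d := EuclideanSpace.single i (1:ℝ)

lemma hasDerivAt_line {f : Ed d → ℝ} {f' : ℝ} {p v : Ed d} {t : ℝ}
    (h : HasLineDerivAt ℝ f f' (p + t • v) v) : HasDerivAt (fun s : ℝ => f (p + s • v)) f' t := by
  have h1 : HasDerivAt (fun s : ℝ => f (p + t • v + s • v)) f' (t - t) := by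
    rw [sub_self]; exact h
  have h2 := HasDerivAt.comp_sub_const t t h1
  refine h2.congr_of_eventuallyEq (Eventually.of_forall fun s => ?_)
  simp only
  congr 1
  rw [add_assoc, ← add_smul]; congr 2; ring

lemma hasLineDerivAt_add {f : Ed d → ℝ} {f' : ℝ} {x v c : Ed d}
    (h : HasLineDerivAt ℝ f f' (x + c) v) : HasLineDerivAt ℝ (fun y => f (y + c)) f' x v := by
  unfold HasLineDerivAt at *
  refine h.congr_of_eventuallyEq (Eventually.of_forall fun s => ?_)
  simp only
  congr 1
  abel

lemma line_mvt (f : Ed d → ℝ) (f' : ℝ → ℝ) (p v : Ed d) (L ε t : ℝ)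
    (h : ∀ τ ∈ Set.uIcc 0 t, HasLineDerivAt ℝ f (f' τ) (p + τ • v) v ∧ |f' τ - L| ≤ ε) :
    |f (p + t • v) - f p - t * L| ≤ ε * |t| := by
  have key := (convex_uIcc (0:ℝ) t).norm_image_sub_le_of_norm_hasDerivWithin_le
    (f := fun τ => f (p + τ • v) - τ * L) (f' := fun τ => f' τ - L) (C := ε) (x := 0) (y := t)
    (fun τ hτ => by
      have h1 := hasDerivAt_line (h τ hτ).1
      have h2 : HasDerivAt (fun τ : ℝ => τ * L) L τ := by
        simpa using (hasDerivAt_id τ).mul_const L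
      exact (h1.sub h2).hasDerivWithinAt)
    (fun τ hτ => by rw [Real.norm_eq_abs]; exact (h τ hτ).2) Set.left_mem_uIcc Set.right_mem_uIcc
  simp only [Real.norm_eq_abs, zero_smul, add_zero, zero_mul, sub_zero] at key
  convert key using 2
  ring

lemma abs_le_of_mem_uIcc {t τ : ℝ} (h : τ ∈ Set.uIcc 0 t) : |τ| ≤ |t| := by
  simpa using Set.abs_sub_left_of_mem_uIcc h

lemma schwarz {g : Ed d → ℝ} {s : Set (Ed d)} (hs : IsOpen s) {i j : Fin d}
    (hi : ∀ x ∈ s, LineDifferentiableAt ℝ g x (ee i))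
    (hj : ∀ x ∈ s, LineDifferentiableAt ℝ g x (ee j))
    (hji : ∀ x ∈ s, LineDifferentiableAt ℝ (pd j g) x (ee i))
    (hc : ContinuousOn (pd i (pd j g)) s) {x : Ed d} (hx : x ∈ s) :
    HasLineDerivAt ℝ (pd i g) (pd i (pd j g) x) x (ee j) := by
  set L := pd i (pd j g) x with hL
  have hn : ∀ k : Fin d, ‖ee k‖ = 1 := fun k => by simp [ee]
  unfold HasLineDerivAt
  rw [hasDerivAt_iff_isLittleO_nhds_zero, Asymptotics.isLittleO_iff]
  intro ε hε
  obtain ⟨δ, hδ, hB⟩ : ∃ δ > 0, ∀ y, dist y x < δ → y ∈ s ∧ |pd i (pd j g) y - L| ≤ ε := by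
    have h1 : ∀ᶠ y in 𝓝 x, y ∈ s ∧ |pd i (pd j g) y - L| ≤ ε := by
      refine (hs.eventually_mem hx).and ?_
      have := (hc.continuousAt (hs.mem_nhds hx))
      have := Metric.tendsto_nhds.1 this ε hε
      filter_upwards [this] with y hy
      exact hy.le
    obtain ⟨δ, hδ, h⟩ := Metric.eventually_nhds_iff.1 h1
    exact ⟨δ, hδ, fun y hy => h hy⟩
  have hnear : ∀ a b : ℝ, |a| < δ/2 → |b| < δ/2 → dist (x + a • ee i + b • ee j) x < δ := by
    intro a b ha hb
    rw [dist_eq_norm]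
    have : x + a • ee i + b • ee j - x = a • ee i + b • ee j := by abel
    rw [this]
    refine (norm_add_le _ _).trans_lt ?_
    rw [norm_smul, norm_smul, hn, hn, Real.norm_eq_abs, Real.norm_eq_abs]
    linarith
  have hsmall : ∀ᶠ t : ℝ in 𝓝 0, |t| < δ/2 := by
    have := Metric.ball_mem_nhds (0:ℝ) (half_pos hδ)
    filter_upwards [this] with t ht
    simpa using ht
  filter_upwards [hsmall] with t ht
  simp only [zero_add, zero_smul, add_zero, smul_eq_mul, Real.norm_eq_abs]
  -- derivative of w
  have hA : HasLineDerivAt ℝ g (pd i g (x + t • ee j)) (x + t • ee j) (ee i) :=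
    (hi _ (hB _ (by simpa using hnear 0 t (by simpa using half_pos hδ) ht)).1).hasLineDerivAt
  have hA0 : HasLineDerivAt ℝ g (pd i g x) x (ee i) := (hi _ hx).hasLineDerivAt
  have hw : HasDerivAt (fun a : ℝ => g (x + t • ee j + a • ee i) - g (x + a • ee i) - a * (t * L))
      (pd i g (x + t • ee j) - pd i g x - t * L) 0 := by
    have h2 : HasDerivAt (fun a : ℝ => a * (t * L)) (t * L) 0 := by
      simpa using (hasDerivAt_id (0:ℝ)).mul_const (t * L)
    exact (HasDerivAt.sub hA hA0).sub h2
  have := hw.le_of_lip' (C := ε * |t|) (by positivity) ?_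
  · simpa using this
  filter_upwards [hsmall] with a ha
  have key := line_mvt (fun y => g (y + a • ee i) - g y)
    (fun τ => pd j g (x + τ • ee j + a • ee i) - pd j g (x + τ • ee j)) x (ee j) (a * L)
    (ε * |a|) t ?_
  · simp only [Real.norm_eq_abs, zero_smul, add_zero, zero_mul, sub_zero]
    have e : g (x + t • ee j + a • ee i) - g (x + a • ee i) - a * (t * L)
        - (g (x + t • ee j) - g x) =
      g (x + t • ee j + a • ee i) - g (x + t • ee j) - (g (x + a • ee i) - g x)
        - t * (a * L) := by ring
    rw [e]
    calc _ ≤ _ := key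
      _ = _ := by ring
  · intro τ hτ
    have hτ' := (abs_le_of_mem_uIcc hτ).trans_lt ht
    constructor
    · refine HasDerivAt.sub ?_ ?_
      · apply hasLineDerivAt_add
        refine (hj _ (hB _ ?_).1).hasLineDerivAt
        rw [add_right_comm]; exact hnear a τ ha hτ'
      · refine (hj _ (hB _ ?_).1).hasLineDerivAt
        simpa using hnear 0 τ (by simpa using half_pos hδ) hτ'
    · have := line_mvt (pd j g) (fun b => pd i (pd j g) (x + τ • ee j + b • ee i)) (x + τ • ee j)
        (ee i) L ε a ?_
      · exact this
      intro b hb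
      have hb' := (abs_le_of_mem_uIcc hb).trans_lt ha
      have := hB (x + τ • ee j + b • ee i) (by rw [add_right_comm]; exact hnear b τ hb' hτ')
      exact ⟨(hji _ this.1).hasLineDerivAt, this.2⟩

lemma hasFDerivAt_of_pd {f : Ed d → ℝ} {s : Set (Ed d)} (hs : IsOpen s)
    (hi : ∀ i, ∀ x ∈ s, LineDifferentiableAt ℝ f x (ee i))
    (hc : ∀ i, ContinuousOn (pd i f) s) {x : Ed d} (hx : x ∈ s) :
    HasFDerivAt f (∑ i, pd i f x • (EuclideanSpace.proj i : Ed d →L[ℝ] ℝ)) x := by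
  have hn : ∀ k : Fin d, ‖ee k‖ = 1 := fun k => by simp [ee]
  have key : ∀ S : Finset (Fin d),
      (fun h : Ed d => f (x + ∑ i ∈ S, h i • ee i) - f x - ∑ i ∈ S, h i * pd i f x)
        =o[𝓝 0] fun h => h := by
    intro S
    induction S using Finset.induction_on with
    | empty => simp
    | insert j S hj ih =>
      have h2 : (fun h : Ed d => f (x + ∑ i ∈ S, h i • ee i + h j • ee j)
          - f (x + ∑ i ∈ S, h i • ee i) - h j * pd j f x) =o[𝓝 0] fun h => h := by
        rw [Asymptotics.isLittleO_iff]
        intro ε hε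
        have h1 : ∀ᶠ y in 𝓝 x, y ∈ s ∧ |pd j f y - pd j f x| ≤ ε := by
          refine (hs.eventually_mem hx).and ?_
          have := ((hc j).continuousAt (hs.mem_nhds hx))
          have := Metric.tendsto_nhds.1 this ε hε
          filter_upwards [this] with y hy
          exact hy.le
        obtain ⟨δ, hδ, hB⟩ := Metric.eventually_nhds_iff.1 h1
        have c1 : Tendsto (fun h : Ed d => ∑ i ∈ S, h i • ee i) (𝓝 0) (𝓝 0) := by
          have : Continuous (fun h : Ed d => ∑ i ∈ S, h i • ee i) := by fun_prop
          simpa using this.tendsto 0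
        have c2 : Tendsto (fun h : Ed d => h j) (𝓝 0) (𝓝 0) := by
          have : Continuous (fun h : Ed d => h j) := by fun_prop
          simpa using this.tendsto 0
        filter_upwards [c1 (Metric.ball_mem_nhds _ (half_pos hδ)),
          c2 (Metric.ball_mem_nhds _ (half_pos hδ))] with h h3 h4
        simp only [Set.mem_preimage, mem_ball, dist_zero_right, Real.norm_eq_abs] at h3 h4
        have := line_mvt f (fun τ => pd j f (x + ∑ i ∈ S, h i • ee i + τ • ee j))
          (x + ∑ i ∈ S, h i • ee i) (ee j) (pd j f x) ε (h j) ?_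
        · refine this.trans ?_
          gcongr
          exact (PiLp.norm_apply_le h j)
        · intro τ hτ
          have hτ' := (abs_le_of_mem_uIcc hτ).trans_lt h4
          have := @hB (x + ∑ i ∈ S, h i • ee i + τ • ee j) (by
            rw [dist_eq_norm, add_assoc, add_sub_cancel_left]
            refine (norm_add_le _ _).trans_lt ?_
            rw [norm_smul, hn, Real.norm_eq_abs]; linarith)
          exact ⟨(hi j _ this.1).hasLineDerivAt, this.2⟩
      refine (ih.add h2).congr_left fun h => ?_
      rw [Finset.sum_insert hj, Finset.sum_insert hj, add_comm (h j • ee j), ← add_assoc]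
      ring
  rw [hasFDerivAt_iff_isLittleO_nhds_zero]
  refine (key Finset.univ).congr_left fun h => ?_
  have : ∑ i, h i • ee i = h := by
    ext k
    simp [ee, Finset.sum_apply, Pi.single_apply]
  rw [this]
  simp [mul_comm]

lemma pd_congr {s : Set (Ed d)} (hs : IsOpen s) {f g : Ed d → ℝ} (h : Set.EqOn f g s) (i : Fin d) :
    Set.EqOn (pd i f) (pd i g) s := fun x hx =>
  Filter.EventuallyEq.lineDeriv_eq (h.eventuallyEq_of_mem (hs.mem_nhds hx))

lemma contDiffOn_succ_of_pd {f : Ed d → ℝ} {s : Set (Ed d)} (hs : IsOpen s) (n : ℕ)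
    (hi : ∀ i, ∀ x ∈ s, LineDifferentiableAt ℝ f x (ee i))
    (hc : ∀ i, ContDiffOn ℝ n (pd i f) s) : ContDiffOn ℝ (n + 1 : ℕ) f s := by
  have hd := fun x (hx : x ∈ s) => hasFDerivAt_of_pd hs hi (fun i => (hc i).continuousOn) hx
  push_cast
  rw [contDiffOn_succ_iff_fderiv_of_isOpen hs]
  refine ⟨fun x hx => (hd x hx).differentiableAt.differentiableWithinAt, by simp, ?_⟩
  have : ContDiffOn ℝ n (fun x => ∑ i, pd i f x • (EuclideanSpace.proj i : Ed d →L[ℝ] ℝ)) s :=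
    ContDiffOn.sum fun i _ => (hc i).smul contDiffOn_const
  exact this.congr fun x hx => (hd x hx).fderiv

lemma pd_eq_fderiv {f : Ed d → ℝ} {x : Ed d} (h : DifferentiableAt ℝ f x) (i : Fin d) :
    pd i f x = fderiv ℝ f x (ee i) := h.lineDeriv_eq_fderiv

lemma ContDiffOn.pd {f : Ed d → ℝ} {s : Set (Ed d)} (hs : IsOpen s) {n : ℕ}
    (h : ContDiffOn ℝ (n + 1 : ℕ) f s) (i : Fin d) : ContDiffOn ℝ n (_root_.pd i f) s := by
  push_cast at h
  have h' := (contDiffOn_succ_iff_fderiv_of_isOpen hs).1 h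
  have : ContDiffOn ℝ n (fun x => fderiv ℝ f x (ee i)) s := h'.2.2.clm_apply contDiffOn_const
  exact this.congr fun x hx => pd_eq_fderiv (h'.1.differentiableAt (hs.mem_nhds hx)) i


section

lemma mderiv_word (k : MIdx d) : ∃ w : List (Fin d), w.length = mdeg k ∧
    ∀ f : Ed d → ℝ, mderiv k f = w.foldr pd f := by
  have key : ∀ L : List (Fin d), ∃ w : List (Fin d), w.length = (L.map k).sum ∧
      ∀ f : Ed d → ℝ, L.foldr (fun i g => (pd i)^[k i] g) f = w.foldr pd f := by
    intro L
    induction L with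
    | nil => exact ⟨[], by simp, fun f => by simp⟩
    | cons i L ih =>
      obtain ⟨w, hw, h⟩ := ih
      have hr : ∀ (n : ℕ) (g : Ed d → ℝ), (pd i)^[n] g = (List.replicate n i).foldr pd g := by
        intro n g
        induction n with
        | zero => simp
        | succ n ih => rw [Function.iterate_succ_apply', ih, List.replicate_succ]; simp
      refine ⟨List.replicate (k i) i ++ w, by simp [hw], fun f => ?_⟩
      rw [List.foldr_cons, h, hr, List.foldr_append]
  obtain ⟨w, hw, h⟩ := key (List.finRange d)
  refine ⟨w, ?_, h⟩
  rw [hw, mdeg, ← List.sum_ofFn, List.ofFn_eq_map]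

lemma mderiv_add_single (k : MIdx d) (j : Fin d) (hk : ∀ l < j, k l = 0) (f : Ed d → ℝ) :
    mderiv (k + Pi.single j 1) f = pd j (mderiv k f) := by
  have key : ∀ L : List (Fin d), L.Pairwise (· < ·) → j ∈ L →
      L.foldr (fun i g => (pd i)^[(k + Pi.single j 1 : MIdx d) i] g) f
        = pd j (L.foldr (fun i g => (pd i)^[k i] g) f) := by
    intro L
    induction L with
    | nil => intro _ h; simp at h
    | cons a L ih =>
      intro hL hj
      rw [List.pairwise_cons] at hL
      rw [List.foldr_cons, List.foldr_cons]
      by_cases haj : a = j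
      · subst haj
        have : L.foldr (fun i g => (pd i)^[(k + Pi.single a 1 : MIdx d) i] g) f
            = L.foldr (fun i g => (pd i)^[k i] g) f := by
          apply List.foldr_ext
          intro b hb g
          have : b ≠ a := (hL.1 b hb).ne'
          simp [this]
        rw [this]
        simp only [Pi.add_apply, Pi.single_eq_same]
        rw [Function.iterate_succ_apply']
      · have hj' : j ∈ L := by
          rcases List.mem_cons.1 hj with h | h
          · exact absurd h.symm haj
          · exact h
        have : k a = 0 := hk a (hL.1 j hj')
        simp only [Pi.add_apply, this, Pi.single_eq_of_ne haj, add_zero, Function.iterate_zero, id]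
        exact ih hL.2 hj'
  exact key _ (List.pairwise_lt_finRange d) (List.mem_finRange j)

lemma mdeg_add_single (k : MIdx d) (j : Fin d) : mdeg (k + Pi.single j 1) = mdeg k + 1 := by
  simp [mdeg, Finset.sum_add_distrib]

lemma pd_mderiv {N : ℕ} {s : Set (Ed d)} (hs : IsOpen s) {f : Ed d → ℝ} (hf : IsCrOn N s f) :
    ∀ n : ℕ, ∀ k : MIdx d, mdeg k = n → n < N → ∀ i : Fin d,
      Set.EqOn (pd i (mderiv k f)) (mderiv (k + Pi.single i 1) f) s := by
  intro n
  induction n with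
  | zero =>
    intro k hk hn i
    rw [mderiv_add_single]
    · exact fun x hx => rfl
    · intro l _
      have := Finset.sum_eq_zero_iff.1 hk l (Finset.mem_univ _)
      exact this
  | succ n ih =>
    intro k hk hn i
    by_cases h0 : ∀ l < i, k l = 0
    · rw [mderiv_add_single _ _ h0]; exact fun x hx => rfl
    push Not at h0
    obtain ⟨l, hli, hl⟩ := h0
    -- first nonzero index
    have hne : (Finset.univ.filter fun l => k l ≠ 0).Nonempty := ⟨l, by simpa using hl⟩
    obtain ⟨j, hj1, hj2, hji⟩ : ∃ j, k j ≠ 0 ∧ (∀ l < j, k l = 0) ∧ j < i := by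
      refine ⟨(Finset.univ.filter fun l => k l ≠ 0).min' hne, ?_, ?_, ?_⟩
      · have := Finset.min'_mem _ hne
        simpa using this
      · intro l hl
        by_contra h
        exact absurd (Finset.min'_le _ l (by simpa using h)) (not_le.2 hl)
      · exact lt_of_le_of_lt (Finset.min'_le _ l (by simpa using hl)) hli
    obtain ⟨k', rfl⟩ : ∃ k' : MIdx d, k = k' + Pi.single j 1 := by
      refine ⟨k - Pi.single j 1, ?_⟩
      funext a
      by_cases ha : a = j
      · subst ha; simp; omega
      · simp [ha]
    rw [mdeg_add_single] at hk
    have hk' : mdeg k' = n := by omega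
    have hz : ∀ l < j, k' l = 0 := fun l hl => by
      have := hj2 l hl
      simp [hl.ne] at this
      exact this
    have hz2 : ∀ l < j, (k' + Pi.single i 1 : MIdx d) l = 0 := fun l hl => by
      simp [hz l hl, (hl.trans hji).ne]
    have IH := ih k' hk' (by omega) i
    have e1 : Set.EqOn (pd j (pd i (mderiv k' f))) (mderiv (k' + Pi.single i 1 + Pi.single j 1) f) s := by
      rw [mderiv_add_single _ j hz2]
      exact pd_congr hs IH j
    rw [mderiv_add_single _ j hz, add_right_comm]
    intro x hx
    have hdi : ∀ x ∈ s, LineDifferentiableAt ℝ (mderiv k' f) x (ee i) :=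
      (hf k' (by omega)).2 (by omega) i
    have hdj : ∀ x ∈ s, LineDifferentiableAt ℝ (mderiv k' f) x (ee j) :=
      (hf k' (by omega)).2 (by omega) j
    have hdij : ∀ x ∈ s, LineDifferentiableAt ℝ (pd i (mderiv k' f)) x (ee j) := by
      intro x hx
      have := (hf (k' + Pi.single i 1) (by rw [mdeg_add_single]; omega)).2
        (by rw [mdeg_add_single]; omega) j x hx
      exact this.congr_of_eventuallyEq (IH.eventuallyEq_of_mem (hs.mem_nhds hx))
    have hcc : ContinuousOn (pd j (pd i (mderiv k' f))) s := by
      have := (hf (k' + Pi.single i 1 + Pi.single j 1) (by simp only [mdeg_add_single]; omega)).1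
      exact this.congr e1
    have := schwarz hs hdj hdi hdij hcc hx
    rw [← e1 hx]
    exact this.lineDeriv

/-- Scale-uniform bounds of derivatives up to order `N` of a family of functions. -/
def Bd (A : ℕ → Set (Ed d)) : ℕ → ℝ → (ℕ → Ed d → ℝ) → Prop
  | 0, a, F => (∀ n, ContDiffOn ℝ (0 : ℕ) (F n) (A n)) ∧
      ∃ C : ℝ, 0 ≤ C ∧ ∀ n, ∀ z ∈ A n, |F n z| ≤ C * 2 ^ (a * n)
  | N + 1, a, F => ((∀ n, ContDiffOn ℝ (N + 1 : ℕ) (F n) (A n)) ∧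
      ∃ C : ℝ, 0 ≤ C ∧ ∀ n, ∀ z ∈ A n, |F n z| ≤ C * 2 ^ (a * n)) ∧
      ∀ i, Bd A N (a + 1) (fun n => pd i (F n))

variable {A : ℕ → Set (Ed d)}

lemma Bd.base {N : ℕ} {a : ℝ} {F : ℕ → Ed d → ℝ} (h : Bd A N a F) :
    (∀ n, ContDiffOn ℝ N (F n) (A n)) ∧
      ∃ C : ℝ, 0 ≤ C ∧ ∀ n, ∀ z ∈ A n, |F n z| ≤ C * 2 ^ (a * n) := by
  cases N with
  | zero => exact h
  | succ N => exact h.1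

lemma Bd.congr (hA : ∀ n, IsOpen (A n)) {N : ℕ} : ∀ {a : ℝ} {F G : ℕ → Ed d → ℝ}, Bd A N a F →
    (∀ n, Set.EqOn (G n) (F n) (A n)) → Bd A N a G := by
  have hb : ∀ (N : ℕ) {a : ℝ} {F G : ℕ → Ed d → ℝ}, ((∀ n, ContDiffOn ℝ N (F n) (A n)) ∧
      ∃ C : ℝ, 0 ≤ C ∧ ∀ n, ∀ z ∈ A n, |F n z| ≤ C * 2 ^ (a * n)) →
      (∀ n, Set.EqOn (G n) (F n) (A n)) → ((∀ n, ContDiffOn ℝ N (G n) (A n)) ∧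
      ∃ C : ℝ, 0 ≤ C ∧ ∀ n, ∀ z ∈ A n, |G n z| ≤ C * 2 ^ (a * n)) := by
    rintro N a F G ⟨h1, C, hC, h2⟩ he
    exact ⟨fun n => (h1 n).congr (he n), C, hC, fun n z hz => by rw [he n hz]; exact h2 n z hz⟩
  induction N with
  | zero => intro a F G h he; exact hb 0 h he
  | succ N ih =>
    intro a F G h he
    exact ⟨hb (N + 1) h.1 he, fun i => ih (h.2 i) fun n => pd_congr (hA n) (he n) i⟩

lemma Bd.pred {N : ℕ} : ∀ {a : ℝ} {F : ℕ → Ed d → ℝ}, Bd A (N + 1) a F → Bd A N a F := by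
  induction N with
  | zero => intro a F h; exact ⟨fun n => (h.1.1 n).of_le (by simp), h.1.2⟩
  | succ N ih =>
    intro a F h
    exact ⟨⟨fun n => (h.1.1 n).of_le (by norm_cast; omega), h.1.2⟩, fun i => ih (h.2 i)⟩

lemma Bd.diff (hA : ∀ n, IsOpen (A n)) {N : ℕ} {a : ℝ} {F : ℕ → Ed d → ℝ} (h : Bd A (N + 1) a F)
    (n : ℕ) {z : Ed d} (hz : z ∈ A n) : DifferentiableAt ℝ (F n) z :=
  (((h.1.1 n).differentiableOn (by simp)) z hz).differentiableAt ((hA n).mem_nhds hz)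

lemma Bd.add (hA : ∀ n, IsOpen (A n)) {N : ℕ} : ∀ {a : ℝ} {F G : ℕ → Ed d → ℝ}, Bd A N a F →
    Bd A N a G → Bd A N a (fun n z => F n z + G n z) := by
  have hb : ∀ (N : ℕ) {a : ℝ} {F G : ℕ → Ed d → ℝ}, ((∀ n, ContDiffOn ℝ N (F n) (A n)) ∧
      ∃ C : ℝ, 0 ≤ C ∧ ∀ n, ∀ z ∈ A n, |F n z| ≤ C * 2 ^ (a * n)) →
      ((∀ n, ContDiffOn ℝ N (G n) (A n)) ∧
      ∃ C : ℝ, 0 ≤ C ∧ ∀ n, ∀ z ∈ A n, |G n z| ≤ C * 2 ^ (a * n)) →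
      ((∀ n, ContDiffOn ℝ N (fun z => F n z + G n z) (A n)) ∧
      ∃ C : ℝ, 0 ≤ C ∧ ∀ n, ∀ z ∈ A n, |F n z + G n z| ≤ C * 2 ^ (a * n)) := by
    rintro N a F G ⟨h1, C, hC, h2⟩ ⟨h1', C', hC', h2'⟩
    refine ⟨fun n => (h1 n).add (h1' n), C + C', by positivity, fun n z hz => ?_⟩
    refine (abs_add_le _ _).trans ?_
    rw [add_mul]
    exact add_le_add (h2 n z hz) (h2' n z hz)
  induction N with
  | zero => intro a F G h he; exact hb 0 h he
  | succ N ih =>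
    intro a F G h h'
    refine ⟨hb (N + 1) h.1 h'.1, fun i => (ih (h.2 i) (h'.2 i)).congr hA fun n z hz => ?_⟩
    have d1 := h.diff hA n hz
    have d2 := h'.diff hA n hz
    change pd i (fun z => F n z + G n z) z = pd i (F n) z + pd i (G n) z
    rw [pd_eq_fderiv (d1.fun_add d2), pd_eq_fderiv d1, pd_eq_fderiv d2, fderiv_fun_add d1 d2]
    rfl

lemma Bd.mul (hA : ∀ n, IsOpen (A n)) {N : ℕ} : ∀ {a b : ℝ} {F G : ℕ → Ed d → ℝ}, Bd A N a F →
    Bd A N b G → Bd A N (a + b) (fun n z => F n z * G n z) := by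
  have hb : ∀ (N : ℕ) {a b : ℝ} {F G : ℕ → Ed d → ℝ}, ((∀ n, ContDiffOn ℝ N (F n) (A n)) ∧
      ∃ C : ℝ, 0 ≤ C ∧ ∀ n, ∀ z ∈ A n, |F n z| ≤ C * 2 ^ (a * n)) →
      ((∀ n, ContDiffOn ℝ N (G n) (A n)) ∧
      ∃ C : ℝ, 0 ≤ C ∧ ∀ n, ∀ z ∈ A n, |G n z| ≤ C * 2 ^ (b * n)) →
      ((∀ n, ContDiffOn ℝ N (fun z => F n z * G n z) (A n)) ∧
      ∃ C : ℝ, 0 ≤ C ∧ ∀ n, ∀ z ∈ A n, |F n z * G n z| ≤ C * 2 ^ ((a + b) * n)) := by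
    rintro N a b F G ⟨h1, C, hC, h2⟩ ⟨h1', C', hC', h2'⟩
    refine ⟨fun n => (h1 n).mul (h1' n), C * C', by positivity, fun n z hz => ?_⟩
    rw [abs_mul, add_mul, Real.rpow_add two_pos]
    calc _ ≤ _ := mul_le_mul (h2 n z hz) (h2' n z hz) (abs_nonneg _) (by positivity)
      _ = _ := by ring
  induction N with
  | zero => intro a b F G h he; exact hb 0 h he
  | succ N ih =>
    intro a b F G h h'
    refine ⟨hb (N + 1) h.1 h'.1, fun i => ?_⟩
    have t1 := ih h.pred (h'.2 i)
    have t2 := ih (h.2 i) h'.pred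
    rw [← add_assoc] at t1
    rw [add_right_comm] at t2
    refine (t1.add hA t2).congr hA fun n z hz => ?_
    have d1 := h.diff hA n hz
    have d2 := h'.diff hA n hz
    change pd i (fun z => F n z * G n z) z = F n z * pd i (G n) z + pd i (F n) z * G n z
    rw [pd_eq_fderiv (d1.fun_mul d2), pd_eq_fderiv d1, pd_eq_fderiv d2, fderiv_fun_mul d1 d2]
    simp [mul_comm]

lemma Bd.ite {N : ℕ} (P : ℕ → Prop) : ∀ {a : ℝ} {F G : ℕ → Ed d → ℝ},
    Bd A N a F → Bd A N a G → Bd A N a (fun n => if P n then F n else G n) := by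
  have hb : ∀ (N : ℕ) {a : ℝ} {F G : ℕ → Ed d → ℝ}, ((∀ n, ContDiffOn ℝ N (F n) (A n)) ∧
      ∃ C : ℝ, 0 ≤ C ∧ ∀ n, ∀ z ∈ A n, |F n z| ≤ C * 2 ^ (a * n)) →
      ((∀ n, ContDiffOn ℝ N (G n) (A n)) ∧
      ∃ C : ℝ, 0 ≤ C ∧ ∀ n, ∀ z ∈ A n, |G n z| ≤ C * 2 ^ (a * n)) →
      ((∀ n, ContDiffOn ℝ N (if P n then F n else G n) (A n)) ∧
      ∃ C : ℝ, 0 ≤ C ∧ ∀ n, ∀ z ∈ A n, |(if P n then F n else G n) z| ≤ C * 2 ^ (a * n)) := by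
    rintro N a F G ⟨h1, C, hC, h2⟩ ⟨h1', C', hC', h2'⟩
    refine ⟨fun n => by split_ifs <;> simp [h1 n, h1' n], C + C', by positivity, fun n z hz => ?_⟩
    have p : (0:ℝ) ≤ 2 ^ (a * n) := by positivity
    split_ifs
    · refine (h2 n z hz).trans ?_
      gcongr; linarith
    · refine (h2' n z hz).trans ?_
      gcongr; linarith
  induction N with
  | zero => intro a F G h he; exact hb 0 h he
  | succ N ih =>
    intro a F G h h'
    refine ⟨hb (N + 1) h.1 h'.1, fun i => ?_⟩
    have := ih (h.2 i) (h'.2 i)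
    convert this using 2 with n
    by_cases hP : P n <;> simp [hP]

lemma Bd.word {a : ℝ} {F : ℕ → Ed d → ℝ} (w : List (Fin d)) : ∀ {N : ℕ},
    Bd A (N + w.length) a F → Bd A N (a + w.length) (fun n => w.foldr pd (F n)) := by
  induction w with
  | nil => intro N h; simpa using h
  | cons i w ih =>
    intro N h
    have := (ih (N := N + 1) (by rw [List.length_cons] at h; convert h using 1; ring)).2 i
    have e : a + ((i :: w).length : ℝ) = a + w.length + 1 := by
      rw [List.length_cons]; push_cast; ring
    rw [e]
    exact this

lemma Bd.mderiv {N : ℕ} {a : ℝ} {F : ℕ → Ed d → ℝ} (k : MIdx d)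
    (h : Bd A (N + mdeg k) a F) : Bd A N (a + mdeg k) (fun n => mderiv k (F n)) := by
  obtain ⟨w, hw, e⟩ := mderiv_word k
  simp only [e]
  rw [← hw] at h ⊢
  exact Bd.word w h

lemma Bd.glue (hA : ∀ n, IsOpen (A n)) {B : ℕ → Set (Ed d)} (hB : ∀ n, IsOpen (B n))
    (hAB : ∀ n z, z ∈ A n ∨ z ∈ B n) {N : ℕ} : ∀ {a : ℝ} {F : ℕ → Ed d → ℝ},
    Bd A N a F → (∀ n, ∀ z ∈ B n, F n z = 0) → Bd (fun _ => Set.univ) N a F := by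
  have hb : ∀ (N : ℕ) {a : ℝ} {F : ℕ → Ed d → ℝ}, ((∀ n, ContDiffOn ℝ N (F n) (A n)) ∧
      ∃ C : ℝ, 0 ≤ C ∧ ∀ n, ∀ z ∈ A n, |F n z| ≤ C * 2 ^ (a * n)) →
      (∀ n, ∀ z ∈ B n, F n z = 0) → ((∀ n, ContDiffOn ℝ N (F n) Set.univ) ∧
      ∃ C : ℝ, 0 ≤ C ∧ ∀ n, ∀ z ∈ (Set.univ : Set (Ed d)), |F n z| ≤ C * 2 ^ (a * n)) := by
    rintro N a F ⟨h1, C, hC, h2⟩ h0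
    refine ⟨fun n => ?_, C, hC, fun n z _ => ?_⟩
    · rw [contDiffOn_univ, contDiff_iff_contDiffAt]
      intro z
      rcases hAB n z with hz | hz
      · exact (h1 n).contDiffAt ((hA n).mem_nhds hz)
      · have : F n =ᶠ[𝓝 z] fun _ => 0 := by
          filter_upwards [(hB n).mem_nhds hz] with y hy using h0 n y hy
        exact contDiffAt_const.congr_of_eventuallyEq this
    · rcases hAB n z with hz | hz
      · exact h2 n z hz
      · rw [h0 n z hz, abs_zero]; positivity
  induction N with
  | zero => intro a F h he; exact hb 0 h he
  | succ N ih =>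
    intro a F h h0
    refine ⟨hb (N + 1) h.1 h0, fun i => ih (h.2 i) fun n z hz => ?_⟩
    have := pd_congr (hB n) (f := F n) (g := fun _ => 0) (h0 n) i hz
    rw [this]
    simp [pd, lineDeriv]

lemma pd_scale (φ : Ed d → ℝ) (c b : ℝ) (i : Fin d) (z : Ed d) :
    pd i (fun z => b * φ (c • z)) z = b * c * pd i φ (c • z) := by
  simp only [pd, lineDeriv]
  rw [deriv_const_mul_field, mul_assoc]
  congr 1
  have : (fun t : ℝ => φ (c • (z + t • EuclideanSpace.single i (1:ℝ))))
    = fun t : ℝ => (fun t : ℝ => φ (c • z + t • EuclideanSpace.single i (1:ℝ))) (c * t) := by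
    funext t; simp [smul_add, smul_smul]
  rw [this, deriv_comp_mul_left c (fun t : ℝ => φ (c • z + t • EuclideanSpace.single i (1:ℝ)))]
  simp

lemma pd_test {φ : Ed d → ℝ} (h : IsTest φ) (i : Fin d) : IsTest (pd i φ) := by
  have e : pd i φ = fun x => fderiv ℝ φ x (ee i) := by
    funext x
    exact pd_eq_fderiv ((h.1.differentiable (by simp)) x) i
  constructor
  · rw [e]
    exact (h.1.fderiv_right (m := (⊤ : ℕ∞)) (by simp)).clm_apply contDiff_const
  · rw [e]
    exact h.2.fderiv_apply ℝ _

lemma Bd.bump {N : ℕ} : ∀ {a : ℝ} {φ : Ed d → ℝ}, IsTest φ →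
    Bd A N a (fun n z => (2:ℝ) ^ (a * n) * φ ((2:ℝ) ^ n • z)) := by
  have hb : ∀ (N : ℕ) {a : ℝ} {φ : Ed d → ℝ}, IsTest φ →
      ((∀ n : ℕ, ContDiffOn ℝ N (fun z => (2:ℝ) ^ (a * n) * φ ((2:ℝ) ^ n • z)) (A n)) ∧
      ∃ C : ℝ, 0 ≤ C ∧ ∀ n : ℕ, ∀ z ∈ A n,
        |(2:ℝ) ^ (a * n) * φ ((2:ℝ) ^ n • z)| ≤ C * 2 ^ (a * n)) := by
    intro N a φ h
    obtain ⟨C, hC⟩ := h.2.exists_bound_of_continuous h.1.continuous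
    refine ⟨fun n => ?_, |C|, abs_nonneg _, fun n z _ => ?_⟩
    · have h1 : ContDiff ℝ N φ := h.1.of_le (by exact_mod_cast le_top)
      exact (contDiff_const.mul (h1.comp (contDiff_const_smul _))).contDiffOn
    · rw [abs_mul, abs_of_nonneg (by positivity : (0:ℝ) ≤ 2 ^ (a * n)), mul_comm]
      exact mul_le_mul_of_nonneg_right ((hC _).trans (le_abs_self _)) (by positivity)
  induction N with
  | zero => intro a φ h; exact hb 0 h
  | succ N ih =>
    intro a φ h
    refine ⟨hb (N + 1) h, fun i => ?_⟩
    convert ih (a := a + 1) (pd_test h i) using 3 with n z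
    rw [pd_scale, add_mul, Real.rpow_add two_pos, one_mul, Real.rpow_natCast]

lemma Bd.kernel {N M : ℕ} {s : Set (Ed d)} (hs : IsOpen s) {f : Ed d → ℝ} (hf : IsCrOn M s f)
    (hA : ∀ n, IsOpen (A n)) (hAs : ∀ n, A n ⊆ s) {a : ℝ}
    (hbd : ∀ k : MIdx d, mdeg k ≤ M →
      ∃ C : ℝ, 0 ≤ C ∧ ∀ n : ℕ, ∀ z ∈ A n, |_root_.mderiv k f z| ≤ C * 2 ^ ((a + mdeg k) * n)) :
    ∀ k : MIdx d, mdeg k + N = M → Bd A N (a + mdeg k) (fun _ => _root_.mderiv k f) := by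
  have hcd : ∀ N, ∀ k : MIdx d, mdeg k + N = M → ContDiffOn ℝ N (_root_.mderiv k f) s := by
    intro N
    induction N with
    | zero => 
      intro k hk
      simpa using (hf k (by omega)).1
    | succ N ih =>
      intro k hk
      refine contDiffOn_succ_of_pd hs N (fun i => (hf k (by omega)).2 (by omega) i) fun i => ?_
      exact (ih (k + Pi.single i 1) (by rw [mdeg_add_single]; omega)).congr
        (pd_mderiv hs hf _ k rfl (by omega) i)
  induction N with
  | zero => intro k hk; exact ⟨fun n => (hcd 0 k hk).mono (hAs n), hbd k (by omega)⟩
  | succ N ih =>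
    intro k hk
    refine ⟨⟨fun n => (hcd (N+1) k hk).mono (hAs n), hbd k (by omega)⟩, fun i => ?_⟩
    have := ih (k + Pi.single i 1) (by rw [mdeg_add_single]; omega)
    rw [mdeg_add_single] at this
    push_cast at this
    rw [← add_assoc] at this
    exact this.congr hA fun n => (pd_mderiv hs hf _ k rfl (by omega) i).mono (hAs n)

end


lemma Bd.mono {A : ℕ → Set (Ed d)} {N M : ℕ} {a : ℝ} {F : ℕ → Ed d → ℝ} (hNM : N ≤ M)
    (h : Bd A M a F) : Bd A N a F := by
  induction hNM with
  | refl => exact h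
  | step _ ih => exact ih h.pred

lemma pd_reflect (g : Ed d → ℝ) (b : ℝ) (c : Ed d) (i : Fin d) (y : Ed d) :
    pd i (fun y => b * g (c - y)) y = b * -1 * pd i g (c - y) := by
  simp only [pd, lineDeriv]
  rw [deriv_const_mul_field, mul_assoc]
  congr 1
  have : (fun t : ℝ => g (c - (y + t • EuclideanSpace.single i (1:ℝ))))
    = fun t : ℝ => (fun t : ℝ => g (c - y + t • EuclideanSpace.single i (1:ℝ))) (-t) := by
    funext t; simp only [neg_smul]; congr 1; abel
  rw [this, deriv_comp_neg (f := fun t : ℝ => g (c - y + t • EuclideanSpace.single i (1:ℝ)))]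
  simp

lemma pd_translate (g : Ed d → ℝ) (b : ℝ) (c : Ed d) (i : Fin d) (y : Ed d) :
    pd i (fun y => b * g (y - c)) y = b * pd i g (y - c) := by
  simp only [pd, lineDeriv]
  rw [deriv_const_mul_field]
  congr 2
  funext t
  congr 1; abel

lemma word_reflect (g : Ed d → ℝ) (c : Ed d) (w : List (Fin d)) :
    w.foldr pd (fun y => g (c - y)) = fun y => (-1 : ℝ) ^ w.length * w.foldr pd g (c - y) := by
  induction w with
  | nil => simp
  | cons i w ih =>
    rw [List.foldr_cons, ih]
    funext y
    rw [pd_reflect, List.length_cons, pow_succ, List.foldr_cons]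

lemma word_translate (g : Ed d → ℝ) (b : ℝ) (c : Ed d) (w : List (Fin d)) :
    w.foldr pd (fun y => b * g (y - c)) = fun y => b * w.foldr pd g (y - c) := by
  induction w with
  | nil => simp
  | cons i w ih =>
    rw [List.foldr_cons, ih]
    funext y
    rw [pd_translate, List.foldr_cons]

lemma mderiv_reflect (g : Ed d → ℝ) (c : Ed d) (k : MIdx d) (y : Ed d) :
    mderiv k (fun y => g (c - y)) y = (-1 : ℝ) ^ mdeg k * mderiv k g (c - y) := by
  obtain ⟨w, hw, e⟩ := mderiv_word k
  rw [e, e, word_reflect, hw]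

lemma mixDeriv_eq (g : Ed d → ℝ) (k l : MIdx d) (x y : Ed d) :
    mixDeriv k l (fun x y => g (x - y)) x y = (-1 : ℝ) ^ mdeg l * mderiv k (mderiv l g) (x - y) := by
  unfold mixDeriv
  simp only [mderiv_reflect]
  obtain ⟨w, hw, e⟩ := mderiv_word k
  rw [e, e, word_translate]

lemma word_zero {s : Set (Ed d)} (hs : IsOpen s) {g : Ed d → ℝ} (h : ∀ z ∈ s, g z = 0)
    (w : List (Fin d)) : ∀ z ∈ s, w.foldr pd g z = 0 := by
  induction w with
  | nil => exact h
  | cons i w ih =>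
    intro z hz
    rw [List.foldr_cons, pd_congr hs (g := fun _ => 0) ih i hz]
    simp [pd, lineDeriv]

lemma word_smooth {F : Ed d → ℝ} (hc : HasCompactSupport F) (w : List (Fin d)) : ∀ {N : ℕ},
    ContDiff ℝ (N + w.length : ℕ) F →
      ContDiff ℝ N (w.foldr pd F) ∧ HasCompactSupport (w.foldr pd F) := by
  induction w with
  | nil => intro N h; exact ⟨by simpa using h, hc⟩
  | cons i w ih =>
    intro N h
    have h1 := ih (N := N + 1) (by rw [List.length_cons] at h; convert h using 2; ring)
    rw [List.foldr_cons]
    constructor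
    · rw [← contDiffOn_univ]
      exact ContDiffOn.pd isOpen_univ (contDiffOn_univ.2 h1.1) i
    · have e : pd i (w.foldr pd F) = fun x => fderiv ℝ (w.foldr pd F) x (ee i) := by
        funext x
        exact pd_eq_fderiv ((h1.1.differentiable (by simp)) x) i
      rw [e]
      exact h1.2.fderiv_apply ℝ _

/-- Functions all of whose partial derivatives of order `n` vanish. -/
def PolyLt : ℕ → (Ed d → ℝ) → Prop
  | 0, q => q = 0
  | n + 1, q => ContDiff ℝ (⊤ : ℕ∞) q ∧ ∀ i, PolyLt n (pd i q)

lemma polyLt_zero : ∀ n, PolyLt n (0 : Ed d → ℝ) := by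
  intro n
  induction n with
  | zero => rfl
  | succ n ih =>
    refine ⟨contDiff_const, fun i => ?_⟩
    convert ih
    funext x
    simp [pd, lineDeriv]

lemma PolyLt.succ {n : ℕ} : ∀ {q : Ed d → ℝ}, PolyLt n q → PolyLt (n + 1) q := by
  induction n with
  | zero => intro q h; rw [show q = 0 from h]; exact polyLt_zero 1
  | succ n ih => intro q h; exact ⟨h.1, fun i => ih (h.2 i)⟩

lemma PolyLt.mono {n N : ℕ} (hn : n ≤ N) {q : Ed d → ℝ} (h : PolyLt n q) : PolyLt N q := by
  induction hn with
  | refl => exact h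
  | step _ ih => exact ih.succ

lemma mpow_contDiff (l : MIdx d) : ContDiff ℝ (⊤ : ℕ∞) (fun z : Ed d => mpow z l) := by
  unfold mpow
  refine contDiff_prod fun i _ => ContDiff.pow ?_ _
  exact (EuclideanSpace.proj i : Ed d →L[ℝ] ℝ).contDiff

lemma pd_mpow (b : ℝ) (l : MIdx d) (i : Fin d) (z : Ed d) :
    pd i (fun z => b * mpow z l) z = (b * l i) * mpow z (Function.update l i (l i - 1)) := by
  have e : ∀ t : ℝ, b * mpow (z + t • EuclideanSpace.single i (1:ℝ)) l
      = b * (∏ j ∈ Finset.univ.erase i, z j ^ l j) * (z i + t) ^ l i := by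
    intro t
    unfold mpow
    rw [← Finset.mul_prod_erase _ _ (Finset.mem_univ i)]
    have : ∏ j ∈ Finset.univ.erase i, (z + t • EuclideanSpace.single i (1:ℝ)) j ^ l j
        = ∏ j ∈ Finset.univ.erase i, z j ^ l j := by
      refine Finset.prod_congr rfl fun j hj => ?_
      have : j ≠ i := Finset.ne_of_mem_erase hj
      simp [this]
    rw [this]
    simp
    ring
  simp only [pd, lineDeriv, e]
  have hd : HasDerivAt (fun t : ℝ => b * (∏ j ∈ Finset.univ.erase i, z j ^ l j) * (z i + t) ^ l i)
      (b * (∏ j ∈ Finset.univ.erase i, z j ^ l j) * (l i * (z i + 0) ^ (l i - 1) * 1)) 0 :=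
    (((hasDerivAt_id (0:ℝ)).const_add (z i)).pow (l i)).const_mul _
  rw [hd.deriv]
  unfold mpow
  rw [← Finset.mul_prod_erase _ _ (Finset.mem_univ i)]
  have : ∏ j ∈ Finset.univ.erase i, z j ^ Function.update l i (l i - 1) j
        = ∏ j ∈ Finset.univ.erase i, z j ^ l j := by
    refine Finset.prod_congr rfl fun j hj => ?_
    rw [Function.update_of_ne (Finset.ne_of_mem_erase hj)]
  rw [this, Function.update_self]
  simp
  ring

lemma polyLt_mpow (n : ℕ) : ∀ (b : ℝ) (l : MIdx d), mdeg l = n →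
    PolyLt (n + 1) (fun z : Ed d => b * mpow z l) := by
  induction n with
  | zero =>
    intro b l hl
    refine ⟨contDiff_const.mul (mpow_contDiff l), fun i => ?_⟩
    have : l i = 0 := Finset.sum_eq_zero_iff.1 hl i (Finset.mem_univ _)
    funext z
    rw [pd_mpow]; simp [this]
  | succ n ih =>
    intro b l hl
    refine ⟨contDiff_const.mul (mpow_contDiff l), fun i => ?_⟩
    have e : pd i (fun z : Ed d => b * mpow z l)
      = fun z => (b * l i) * mpow z (Function.update l i (l i - 1)) := by
      funext z; exact pd_mpow b l i z
    rw [e]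
    by_cases h : l i = 0
    · simp only [h, Nat.cast_zero, mul_zero, zero_mul]
      exact polyLt_zero _
    · refine ih _ _ ?_
      unfold mdeg at *
      rw [← Finset.add_sum_erase _ _ (Finset.mem_univ i)] at hl ⊢
      have : ∑ j ∈ Finset.univ.erase i, Function.update l i (l i - 1) j
          = ∑ j ∈ Finset.univ.erase i, l j := by
        refine Finset.sum_congr rfl fun j hj => ?_
        rw [Function.update_of_ne (Finset.ne_of_mem_erase hj)]
      rw [this, Function.update_self]
      omega

lemma ibp {F : Ed d → ℝ} (hc : HasCompactSupport F) (w : List (Fin d)) : ∀ {q : Ed d → ℝ},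
    PolyLt w.length q → ContDiff ℝ (w.length : ℕ) F → ∫ z, q z * w.foldr pd F z = 0 := by
  induction w with
  | nil => intro q h _; rw [show q = 0 from h]; simp
  | cons i w ih =>
    intro q h hF
    rw [List.length_cons] at h hF
    have hH := word_smooth hc w (N := 1) (by rw [add_comm]; exact hF)
    set H := w.foldr pd F with hHd
    have dq : Differentiable ℝ q := h.1.differentiable (by simp)
    have dH : Differentiable ℝ H := hH.1.differentiable (by simp)
    have eq : ∀ z, pd i q z = fderiv ℝ q z (ee i) := fun z => pd_eq_fderiv (dq z) i
    have eH : ∀ z, pd i H z = fderiv ℝ H z (ee i) := fun z => pd_eq_fderiv (dH z) i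
    have cq' : Continuous fun z => fderiv ℝ q z (ee i) :=
      (h.1.continuous_fderiv (by simp)).clm_apply continuous_const
    have cH' : Continuous fun z => fderiv ℝ H z (ee i) :=
      (hH.1.continuous_fderiv (by simp)).clm_apply continuous_const
    have hcH' : HasCompactSupport fun z => fderiv ℝ H z (ee i) := hH.2.fderiv_apply ℝ _
    rw [List.foldr_cons, ← hHd]
    simp only [eH]
    rw [integral_mul_fderiv_eq_neg_fderiv_mul_of_integrable]
    · have := ih (h.2 i) (hF.of_le (by norm_cast; omega))
      simp only [eq] at this
      rw [this, neg_zero]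
    · exact (cq'.mul hH.1.continuous).integrable_of_hasCompactSupport hH.2.mul_left
    · exact (dq.continuous.mul cH').integrable_of_hasCompactSupport hcH'.mul_left
    · exact (dq.continuous.mul hH.1.continuous).integrable_of_hasCompactSupport hH.2.mul_left
    · exact fun x _ => dq x
    · exact fun x _ => dH x

lemma mpow_neg (z : Ed d) (l : MIdx d) : mpow (-z) l = (-1) ^ mdeg l * mpow z l := by
  unfold mpow mdeg
  rw [← Finset.prod_pow_eq_pow_sum, ← Finset.prod_mul_distrib]
  refine Finset.prod_congr rfl fun i _ => ?_
  rw [← mul_pow]; simp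

lemma abs_mpow_le (z : Ed d) (l : MIdx d) : |mpow z l| ≤ ‖z‖ ^ mdeg l := by
  unfold mpow mdeg
  rw [← Finset.prod_pow_eq_pow_sum, Finset.abs_prod]
  refine Finset.prod_le_prod (fun i _ => abs_nonneg _) fun i _ => ?_
  rw [abs_pow]
  exact pow_le_pow_left₀ (abs_nonneg _) (PiLp.norm_apply_le z i) _

lemma poly_conv {G : Ed d → ℝ} (hG : Continuous G) (hc : HasCompactSupport G) (k : MIdx d) :
    ∃ p : MvPolynomial (Fin d) ℝ, p.totalDegree ≤ mdeg k ∧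
      ∀ x : Ed d, (∫ y, G (x - y) * mpow y k) = MvPolynomial.eval (fun i => x i) p := by
  set S := Fintype.piFinset (fun i => Finset.range (k i + 1)) with hS
  set c : MIdx d → Ed d → ℝ := fun j z => ∏ i, ((-z i) ^ (k i - j i) * ((k i).choose (j i) : ℝ))
    with hcdef
  have hcc : ∀ j, Continuous (c j) := by
    intro j
    refine continuous_finsetProd _ fun i _ => ?_
    fun_prop
  refine ⟨∑ j ∈ S, MvPolynomial.C (∫ z, G z * c j z) * ∏ i, MvPolynomial.X i ^ j i, ?_, ?_⟩
  · refine MvPolynomial.totalDegree_finsetSum_le fun j hj => ?_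
    refine (MvPolynomial.totalDegree_mul _ _).trans ?_
    rw [MvPolynomial.totalDegree_C, zero_add]
    refine (MvPolynomial.totalDegree_finsetProd _ _).trans ?_
    refine Finset.sum_le_sum fun i _ => ?_
    rw [MvPolynomial.totalDegree_X_pow]
    have := Fintype.mem_piFinset.1 hj i
    rw [Finset.mem_range] at this
    omega
  · intro x
    have e1 : ∫ y, G (x - y) * mpow y k = ∫ z, G z * mpow (x - z) k := by
      rw [← integral_sub_left_eq_self (fun z => G z * mpow (x - z) k) volume x]
      simp
    have e2 : ∀ z, G z * mpow (x - z) k = ∑ j ∈ S, (G z * c j z) * ∏ i, x i ^ j i := by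
      intro z
      unfold mpow
      have : ∀ i, (x - z) i ^ k i = ∑ a ∈ Finset.range (k i + 1),
          x i ^ a * (-z i) ^ (k i - a) * ((k i).choose a : ℝ) := by
        intro i
        rw [← add_pow, PiLp.sub_apply, sub_eq_add_neg]
      simp only [this]
      rw [Finset.prod_univ_sum, Finset.mul_sum]
      refine Finset.sum_congr rfl fun j _ => ?_
      rw [mul_assoc, hcdef, ← Finset.prod_mul_distrib]
      congr 1
      refine Finset.prod_congr rfl fun i _ => ?_
      ring
    rw [e1]
    simp only [e2]
    rw [integral_finsetSum, map_sum]
    · refine Finset.sum_congr rfl fun j _ => ?_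
      rw [integral_mul_const]
      simp
    · intro j _
      exact ((hG.mul (hcc j)).integrable_of_hasCompactSupport hc.mul_right).mul_const _

lemma exists_unif (M : ℕ) (C : MIdx d → MIdx d → ℝ) :
    ∃ c : ℝ, 0 < c ∧ ∀ k l, mdeg k ≤ M → mdeg l ≤ M → C k l ≤ c := by
  have hf : {k : MIdx d | mdeg k ≤ M}.Finite := by
    refine (Set.finite_Iic (fun _ => M : MIdx d)).subset fun k hk i => ?_
    exact (Finset.single_le_sum (fun _ _ => Nat.zero_le _) (Finset.mem_univ i)).trans hk
  obtain ⟨c, hc⟩ := ((hf.prod hf).image (fun p => C p.1 p.2)).bddAbove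
  refine ⟨max c 1, by positivity, fun k l hk hl => le_max_of_le_left ?_⟩
  exact hc ⟨(k, l), ⟨hk, hl⟩, rfl⟩

lemma rpow_le_eight {u e : ℝ} (h1 : 1 / 8 ≤ u) (h2 : u ≤ 8) : u ^ e ≤ 8 ^ |e| := by
  have hu : 0 < u := by linarith
  rcases le_total 0 e with h | h
  · rw [abs_of_nonneg h]; exact Real.rpow_le_rpow hu.le h2 h
  · rw [abs_of_nonpos h]
    have : u ^ e = (u⁻¹) ^ (-e) := by rw [Real.inv_rpow hu.le, Real.rpow_neg hu.le, inv_inv]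
    rw [this]
    refine Real.rpow_le_rpow (by positivity) ?_ (by linarith)
    rw [inv_le_comm₀ hu (by norm_num)]; linarith


lemma moment_bound {G : Ed d → ℝ} {R M : ℝ} {k l : MIdx d} (hR : 0 ≤ R)
    (hG : ContDiff ℝ (mdeg k : ℕ) G) (hc : HasCompactSupport G)
    (h0 : ∀ z, R < ‖z‖ → G z = 0) (hM : ∀ z, |mderiv k G z| ≤ M) (y : Ed d) :
    |∫ x, mpow (y - x) l * mderiv k (fun y' => G (x - y')) y| ≤
      if mdeg k ≤ mdeg l then R ^ mdeg l * M * (R ^ d * volume.real (ball (0 : Ed d) 1)) else 0 := by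
  have e : ∫ x, mpow (y - x) l * mderiv k (fun y' => G (x - y')) y
      = ∫ z, ((-1) ^ mdeg l * (-1) ^ mdeg k * mpow z l) * mderiv k G z := by
    rw [← integral_sub_right_eq_self
      (fun z => ((-1) ^ mdeg l * (-1) ^ mdeg k * mpow z l) * mderiv k G z) y]
    congr 1
    funext x
    rw [mderiv_reflect, ← neg_sub x y, mpow_neg]
    ring
  rw [e]
  obtain ⟨w, hw, ew⟩ := mderiv_word k
  split_ifs with hkl
  · have hz : ∀ z : Ed d, z ∉ closedBall (0 : Ed d) R →
        ((-1) ^ mdeg l * (-1) ^ mdeg k * mpow z l) * mderiv k G z = 0 := by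
      intro z hz
      have hz' : R < ‖z‖ := by simpa using hz
      rw [ew, word_zero (s := {z | R < ‖z‖}) (isOpen_lt continuous_const continuous_norm) h0 w z hz',
        mul_zero]
    rw [← setIntegral_eq_integral_of_forall_compl_eq_zero hz, ← Real.norm_eq_abs]
    have := norm_setIntegral_le_of_norm_le_const (μ := (volume : Measure (Ed d)))
      (s := closedBall (0 : Ed d) R) (C := R ^ mdeg l * M)
      (f := fun z => ((-1) ^ mdeg l * (-1) ^ mdeg k * mpow z l) * mderiv k G z)
      measure_closedBall_lt_top (fun z hz => by
        have hz' : ‖z‖ ≤ R := by simpa using hz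
        rw [Real.norm_eq_abs, abs_mul]
        refine mul_le_mul ?_ (hM z) (abs_nonneg _) (by positivity)
        rw [abs_mul, abs_mul, abs_pow, abs_pow, abs_neg, abs_one, one_pow, one_pow, one_mul, one_mul]
        exact (abs_mpow_le z l).trans (pow_le_pow_left₀ (norm_nonneg _) hz' _))
    refine this.trans_eq ?_
    rw [Measure.addHaar_real_closedBall _ _ hR, finrank_euclideanSpace_fin]
  · have := ibp hc w (q := fun z => (-1) ^ mdeg l * (-1) ^ mdeg k * mpow z l)
      ((polyLt_mpow _ _ l rfl).mono (by omega)) (by rw [hw]; exact hG)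
    rw [ew, this, abs_zero]


/-- Lemma 2.7, translation invariant regularising kernels: if
`𝖪 : ℝ^d → ℝ` is `C^{m+r}` away from the origin with
`|∂^k 𝖪(z)| ≲ |z|^{-(d-β+|k|)} 1_{|z| ≤ ρ}` for `|k| ≤ m+r`, then `(x,y) ↦ 𝖪(x-y)` is a
`β`-regularising kernel of order `(m,r)` with range `ρ` and it preserves polynomials at
every level `γ`. -/
theorem translation_invariant_regularising
    (d : ℕ) (hd : 0 < d) (β ρ : ℝ) (m r : ℕ) (hβ : 0 < β) (hρ : 0 < ρ)
    (Kf : Ed d → ℝ)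
    (hsm : IsCrOn (m + r) {z : Ed d | z ≠ 0} Kf)
    (hbd : ∃ c : ℝ, ∀ k : MIdx d, mdeg k ≤ m + r → ∀ z : Ed d, z ≠ 0 →
      (‖z‖ ≤ ρ → |mderiv k Kf z| ≤ c * ‖z‖ ^ (β - (d : ℝ) - (mdeg k : ℝ))) ∧
      (ρ < ‖z‖ → mderiv k Kf z = 0)) :
    ∃ Kn : ℕ → Ed d → Ed d → ℝ,
      RegKer d β m r ρ Kn ∧
      (∀ x y : Ed d, x ≠ y → HasSum (fun n => Kn n x y) (Kf (x - y))) ∧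
      (∀ γ : ℝ, PresPoly Kn γ) := by
  obtain ⟨c0, hbd⟩ := hbd
  have hm0 : mderiv (0 : MIdx d) Kf = Kf := by
    obtain ⟨w, hw, ew⟩ := mderiv_word (0 : MIdx d)
    have : w = [] := List.length_eq_zero_iff.1 (by rw [hw]; simp [mdeg])
    rw [ew, this]; rfl
  have hm0' : mdeg (0 : MIdx d) = 0 := by simp [mdeg]
  have hK0 : ∀ z, ρ < ‖z‖ → Kf z = 0 := by
    intro z hz
    have := (hbd 0 (by rw [hm0']; omega) z (norm_pos_iff.1 (hρ.trans hz))).2 hz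
    rwa [hm0] at this
  -- bumps
  let φ : ContDiffBump (0 : Ed d) := ⟨ρ / 2, ρ, by linarith, by linarith⟩
  let φ' : ContDiffBump (0 : Ed d) := ⟨2 * ρ, 3 * ρ, by linarith, by linarith⟩
  have hφ1 : ∀ z, ‖z‖ ≤ ρ / 2 → φ z = 1 := fun z hz =>
    φ.one_of_mem_closedBall (by simpa [φ] using hz)
  have hφ0 : ∀ z, ρ ≤ ‖z‖ → φ z = 0 := fun z hz =>
    φ.zero_of_le_dist (by simpa [φ] using hz)
  have hφ'1 : ∀ z, ‖z‖ ≤ 2 * ρ → φ' z = 1 := fun z hz =>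
    φ'.one_of_mem_closedBall (by simpa [φ'] using hz)
  have tφ : IsTest (φ : Ed d → ℝ) := ⟨φ.contDiff, φ.hasCompactSupport⟩
  have tφ' : IsTest (φ' : Ed d → ℝ) := ⟨φ'.contDiff, φ'.hasCompactSupport⟩
  have tφ2 : IsTest (fun z : Ed d => - φ ((2:ℝ) • z)) := by
    refine ⟨(tφ.1.comp (contDiff_const_smul _)).neg, ?_⟩
    have h1 : HasCompactSupport (fun z : Ed d => φ ((2:ℝ) • z)) :=
      tφ.2.comp_smul (two_ne_zero)
    exact h1.neg
  let a : ℕ → Ed d → ℝ := fun n z => if n = 0 then φ' ((2:ℝ) ^ n • z) else φ ((2:ℝ) ^ n • z)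
  let G : ℕ → Ed d → ℝ := fun n z => (a n z - a (n + 1) z) * Kf z
  let R : ℕ → ℝ := fun n => ρ / 2 ^ n
  have hRp : ∀ n, 0 < R n := fun n => by positivity
  have hRle : ∀ n, R n ≤ ρ := fun n => div_le_self hρ.le (one_le_pow₀ (by norm_num))
  have hRr : ∀ n, R n = ρ * 2 ^ (-(n : ℝ)) := fun n => by
    rw [Real.rpow_neg two_pos.le, Real.rpow_natCast]; rfl
  have hns : ∀ (n : ℕ) (z : Ed d), ‖(2:ℝ) ^ n • z‖ = 2 ^ n * ‖z‖ := fun n z => by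
    rw [norm_smul]; simp
  have hsc : ∀ (n : ℕ) (z : Ed d) , ‖z‖ = R n * (2 ^ n * ‖z‖ / ρ) := fun n z => by
    simp only [R]; field_simp
  let A : ℕ → Set (Ed d) := fun n => {z | R n / 8 < ‖z‖ ∧ ‖z‖ < 2 * R n}
  let B : ℕ → Set (Ed d) := fun n => {z | ‖z‖ < R n / 4 ∨ R n < ‖z‖}
  have hA : ∀ n, IsOpen (A n) := fun n =>
    (isOpen_lt continuous_const continuous_norm).inter (isOpen_lt continuous_norm continuous_const)
  have hB : ∀ n, IsOpen (B n) := fun n =>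
    (isOpen_lt continuous_norm continuous_const).union (isOpen_lt continuous_const continuous_norm)
  have hAB : ∀ n z, z ∈ A n ∨ z ∈ B n := by
    intro n z
    have := hRp n
    by_cases h1 : ‖z‖ < R n / 4
    · exact Or.inr (Or.inl h1)
    by_cases h2 : R n < ‖z‖
    · exact Or.inr (Or.inr h2)
    refine Or.inl ⟨?_, ?_⟩ <;> linarith
  have hAs : ∀ n, A n ⊆ {z : Ed d | z ≠ 0} := by
    intro n z hz h0
    have h1 := hz.1
    have := hRp n
    rw [h0, norm_zero] at h1
    linarith
  have ha1 : ∀ n z, ‖z‖ < R n / 2 → a n z = 1 := by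
    intro n z hz
    have h2 : 2 ^ n * ‖z‖ ≤ ρ / 2 := by
      simp only [R] at hz
      rw [div_right_comm, lt_div_iff₀ (by positivity)] at hz
      linarith
    simp only [a]
    split_ifs
    · exact hφ'1 _ (by rw [hns]; linarith)
    · exact hφ1 _ (by rw [hns]; linarith)
  have ha0 : ∀ n z, n ≠ 0 → R n < ‖z‖ → a n z = 0 := by
    intro n z hn hz
    simp only [a, if_neg hn]
    apply hφ0
    rw [hns]
    simp only [R] at hz
    rw [div_lt_iff₀ (by positivity)] at hz
    linarith
  have hR1 : ∀ n, R (n + 1) = R n / 2 := fun n => by simp only [R]; rw [pow_succ]; field_simp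
  have hG0 : ∀ n, ∀ z ∈ B n, G n z = 0 := by
    intro n z hz
    have hp := hRp n
    simp only [G]
    rcases hz with hz | hz
    · rw [ha1 n z (by linarith), ha1 (n + 1) z (by rw [hR1]; linarith)]; simp
    · rw [ha0 (n + 1) z (by simp) (by rw [hR1]; linarith)]
      by_cases hn : n = 0
      · rw [hK0 z (by rw [hn] at hz; simpa [R] using hz)]; simp
      · rw [ha0 n z hn hz]; simp
  -- bounds
  have hBa : Bd A (m + r) 0 (fun n z => a n z - a (n + 1) z) := by
    have b1 := Bd.ite (fun n => n = 0) (Bd.bump (A := A) (N := m + r) (a := 0) tφ')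
      (Bd.bump (A := A) (N := m + r) (a := 0) tφ)
    have b2 := Bd.bump (A := A) (N := m + r) (a := 0) tφ2
    refine (b1.add hA b2).congr hA fun n z _ => ?_
    simp only [a, zero_mul, Real.rpow_zero, one_mul, smul_smul, ← pow_succ', Nat.succ_ne_zero,
      if_false, sub_eq_add_neg]
    split_ifs <;> rfl
  have hs0 : IsOpen {z : Ed d | z ≠ 0} := isOpen_ne
  have hBK : Bd A (m + r) ((d : ℝ) - β) (fun _ => Kf) := by
    have := Bd.kernel (N := m + r) hs0 hsm hA hAs (a := (d : ℝ) - β) ?_ 0 (by rw [hm0']; omega)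
    · rw [hm0, hm0'] at this
      simpa using this
    intro k hk
    set e : ℝ := β - d - mdeg k with he
    refine ⟨|c0| * (ρ ^ e * 8 ^ |e|), by positivity, fun n z hz => ?_⟩
    have hz0 := hAs n hz
    have hpos : 0 < ‖z‖ := norm_pos_iff.2 hz0
    rcases le_or_gt ‖z‖ ρ with h | h
    · refine ((hbd k hk z hz0).1 h).trans ?_
      have hu1 : 1 / 8 ≤ ‖z‖ / R n := by
        rw [le_div_iff₀ (hRp n)]; have := hz.1; linarith
      have hu2 : ‖z‖ / R n ≤ 8 := by
        rw [div_le_iff₀ (hRp n)]; have := hz.2; have := hRp n; linarith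
      have hsplit : ‖z‖ ^ e = ρ ^ e * (‖z‖ / R n) ^ e * 2 ^ (((d : ℝ) - β + mdeg k) * n) := by
        have h1 : ‖z‖ = ρ * 2 ^ (-(n:ℝ)) * (‖z‖ / R n) := by
          rw [← hRr, mul_div_cancel₀ _ (hRp n).ne']
        conv_lhs => rw [h1]
        rw [Real.mul_rpow (by positivity) (by positivity), Real.mul_rpow hρ.le (by positivity),
          ← Real.rpow_mul two_pos.le]
        rw [show -(n:ℝ) * e = ((d : ℝ) - β + mdeg k) * n by rw [he]; ring]
        ring
      have h8 := rpow_le_eight (e := e) hu1 hu2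
      rw [hsplit]
      calc c0 * (ρ ^ e * (‖z‖ / R n) ^ e * 2 ^ (((d : ℝ) - β + mdeg k) * n))
          ≤ |c0| * (ρ ^ e * (‖z‖ / R n) ^ e * 2 ^ (((d : ℝ) - β + mdeg k) * n)) := by
            gcongr; exact le_abs_self _
        _ ≤ |c0| * (ρ ^ e * 8 ^ |e| * 2 ^ (((d : ℝ) - β + mdeg k) * n)) := by gcongr
        _ = _ := by ring
    · rw [(hbd k hk z hz0).2 h, abs_zero]; positivity
  have hBG : Bd (fun _ => Set.univ) (m + r) ((d : ℝ) - β) G := by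
    have := hBa.mul hA hBK
    rw [zero_add] at this
    exact this.glue hA hB hAB hG0
  have hcd : ∀ n, ContDiff ℝ (m + r : ℕ) (G n) := fun n => contDiffOn_univ.1 (hBG.base.1 n)
  have hG0' : ∀ n z, R n < ‖z‖ → G n z = 0 := fun n z hz => hG0 n z (Or.inr hz)
  have hcs : ∀ n, HasCompactSupport (G n) := fun n =>
    HasCompactSupport.intro (isCompact_closedBall (0 : Ed d) (R n)) fun z hz =>
      hG0' n z (by simpa using hz)
  have hcdl : ∀ (n N : ℕ) (l : MIdx d), N + mdeg l ≤ m + r → ContDiff ℝ N (mderiv l (G n)) :=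
    fun n N l h => contDiffOn_univ.1 (((hBG.mono h).mderiv l).base.1 n)
  have hmix : ∀ (N : ℕ) (k l : MIdx d), N + mdeg k + mdeg l ≤ m + r →
      Bd (fun _ => Set.univ) N ((d : ℝ) - β + mdeg l + mdeg k)
        (fun n => mderiv k (mderiv l (G n))) :=
    fun N k l h => ((hBG.mono h).mderiv l).mderiv k
  have hb1 : ∀ k l : MIdx d, ∃ C : ℝ, mdeg k ≤ m → mdeg l ≤ r → ∀ n z,
      |mderiv k (mderiv l (G n)) z| ≤ C * 2 ^ (((d : ℝ) - β + mdeg l + mdeg k) * n) := by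
    intro k l
    by_cases h : mdeg k ≤ m ∧ mdeg l ≤ r
    · obtain ⟨C, _, hC⟩ := (hmix 0 k l (by omega)).base.2
      exact ⟨C, fun _ _ n z => hC n z (Set.mem_univ _)⟩
    · exact ⟨0, fun h1 h2 => absurd ⟨h1, h2⟩ h⟩
  choose C1 hC1 using hb1
  have hb2 : ∀ k l : MIdx d, ∃ C : ℝ, mdeg k ≤ r → ∀ n y,
      |∫ x, mpow (y - x) l * mderiv k (fun y' => G n (x - y')) y| ≤ C * 2 ^ (-(β * (n : ℝ))) := by
    intro k l
    by_cases hk : mdeg k ≤ r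
    swap
    · exact ⟨0, fun h => absurd h hk⟩
    obtain ⟨C, hC0, hC⟩ := ((hBG.mono (show 0 + mdeg k ≤ m + r by omega)).mderiv k).base.2
    refine ⟨ρ ^ mdeg l * C * (ρ ^ d * volume.real (ball (0 : Ed d) 1)), fun _ n y => ?_⟩
    refine (moment_bound (hRp n).le ((hcd n).of_le (by norm_cast; omega)) (hcs n) (hG0' n)
      (fun z => hC n z (Set.mem_univ _)) y).trans ?_
    split_ifs with hkl
    · have e1 : R n ^ mdeg l = ρ ^ mdeg l * 2 ^ (-((mdeg l : ℝ) * n)) := by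
        rw [hRr, mul_pow, ← Real.rpow_natCast (2 ^ (-(n:ℝ))), ← Real.rpow_mul two_pos.le]
        congr 2; ring
      have e2 : R n ^ d = ρ ^ d * 2 ^ (-((d : ℝ) * n)) := by
        rw [hRr, mul_pow, ← Real.rpow_natCast (2 ^ (-(n:ℝ))), ← Real.rpow_mul two_pos.le]
        congr 2; ring
      rw [e1, e2]
      set V := volume.real (ball (0 : Ed d) 1) with hV
      have hV0 : 0 ≤ V := measureReal_nonneg
      have e3 : (2:ℝ) ^ (-((mdeg l : ℝ) * n)) * 2 ^ (((d : ℝ) - β + mdeg k) * n)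
          * 2 ^ (-((d : ℝ) * n)) ≤ 2 ^ (-(β * (n : ℝ))) := by
        rw [← Real.rpow_add two_pos, ← Real.rpow_add two_pos]
        refine Real.rpow_le_rpow_of_exponent_le one_le_two ?_
        have h1 : (mdeg k : ℝ) ≤ mdeg l := by exact_mod_cast hkl
        have h2 : (mdeg k : ℝ) * n ≤ mdeg l * n := by gcongr
        linarith
      calc _ = ρ ^ mdeg l * C * (ρ ^ d * V) * ((2:ℝ) ^ (-((mdeg l : ℝ) * n))
            * 2 ^ (((d : ℝ) - β + mdeg k) * n) * 2 ^ (-((d : ℝ) * n))) := by ring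
        _ ≤ _ := by gcongr
    · have : 0 ≤ volume.real (ball (0 : Ed d) 1) := measureReal_nonneg
      positivity
  choose C2 hC2 using hb2
  refine ⟨fun n x y => G n (x - y), ⟨?_, ?_, ?_⟩, ?_, ?_⟩
  · intro n k l hk hl
    refine ⟨?_, ?_, ?_⟩
    · simp only [mixDeriv_eq]
      have : Continuous (mderiv k (mderiv l (G n))) :=
        (contDiffOn_univ.1 ((hmix 0 k l (by omega)).base.1 n)).continuous
      exact continuous_const.mul (this.comp (continuous_fst.sub continuous_snd))
    · intro hk' i x y
      simp only [mixDeriv_eq]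
      have : ContDiff ℝ (1 : ℕ) (mderiv k (mderiv l (G n))) :=
        contDiffOn_univ.1 ((hmix 1 k l (by omega)).base.1 n)
      have h2 : Differentiable ℝ (mderiv k (mderiv l (G n))) := this.differentiable (by simp)
      exact DifferentiableAt.lineDifferentiableAt
        (((h2.comp (differentiable_id.sub_const y)).const_mul _) x)
    · intro hl' j x y
      have e : mderiv l (fun y' => G n (x - y')) = fun y => (-1 : ℝ) ^ mdeg l * mderiv l (G n) (x - y) := by
        funext y; exact mderiv_reflect _ _ _ _
      rw [e]
      have h2 : Differentiable ℝ (mderiv l (G n)) :=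
        (hcdl n 1 l (by omega)).differentiable (by simp)
      exact DifferentiableAt.lineDifferentiableAt
        (((h2.comp (differentiable_id.const_sub x)).const_mul _) y)
  · intro n x y h
    rw [← hRr, dist_eq_norm]
    by_contra hlt
    exact h (hG0' n _ (not_le.1 hlt))
  · intro K _
    obtain ⟨c1, hc1, h1⟩ := exists_unif (m + r) C1
    obtain ⟨c2, hc2, h2⟩ := exists_unif (m + r) C2
    refine ⟨max c1 c2, by positivity, ?_, ?_⟩
    · intro n k l hk hl x _ y _
      rw [mixDeriv_eq, abs_mul, abs_pow, abs_neg, abs_one, one_pow, one_mul]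
      refine (hC1 k l hk hl n _).trans ?_
      gcongr
      exact (h1 k l (by omega) (by omega)).trans (le_max_left _ _)
    · intro n k l hk hl y _
      refine (hC2 k l hk n y).trans ?_
      gcongr
      exact (h2 k l (by omega) (by omega)).trans (le_max_right _ _)
  · intro x y hxy
    set z := x - y with hz
    have hz0 : 0 < ‖z‖ := norm_pos_iff.2 (sub_ne_zero.2 hxy)
    obtain ⟨N, hN⟩ : ∃ N : ℕ, ρ / ‖z‖ < 2 ^ N := pow_unbounded_of_one_lt _ one_lt_two
    have hbig : ∀ n, N ≤ n → R n < ‖z‖ := by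
      intro n hn
      simp only [R]
      rw [div_lt_comm₀ (by positivity) hz0]
      exact hN.trans_le (pow_le_pow_right₀ one_le_two hn)
    have hsum : HasSum (fun n => G n z) (∑ n ∈ Finset.range (N + 1), G n z) :=
      hasSum_sum_of_ne_finset_zero (f := fun n => G n z) (s := Finset.range (N + 1))
      (fun n hn => hG0' n z (hbig n (by simp at hn; omega)))
    have e : ∑ n ∈ Finset.range (N + 1), G n z = Kf z := by
      simp only [G]
      rw [← Finset.sum_mul, Finset.sum_range_sub', ha0 (N + 1) z (by simp) (hbig _ (by omega)), sub_zero]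
      rcases le_or_gt ‖z‖ ρ with h | h
      · simp only [a, if_true, pow_zero, one_smul]
        rw [hφ'1 z (by linarith), one_mul]
      · rw [hK0 z h, mul_zero]
    rw [e] at hsum
    exact hsum
  · intro γ n k _
    exact poly_conv (hcd n).continuous (hcs n) k
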